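/- Let N ≥ 4 and let W^N ∈ ℂ^{2^N} be the N-qubit W state. Then the partial trace of the density matrix |W^N⟩⟨W^N| over the last N−3 qubits equals (3/N)·|W³⟩⟨W³| + (1 − 3/N)·|e₀₀₀⟩⟨e₀₀₀| as an 8×8 matrix, where W³ = (1/√3)(e₀₀₁ + e₀₁₀ + e₁₀₀) ∈ ℂ⁸. -/

import Mathlib

open Matrix

/-- Standard basis vector labeled by an index `s`. -/
def basisVec {α : Type*} [DecidableEq α] (s : α) : α → ℂ := fun t => if t = s then 1 else 0

/-- The bit string with a single `1` at position `i`. -/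
def oneAt {n : ℕ} (i : Fin n) : Fin n → Fin 2 := fun j => if j = i then 1 else 0

/-- Partial trace over the second factor. -/
noncomputable def ptrace {α β : Type*} [Fintype β]
    (ρ : Matrix (α × β) (α × β) ℂ) : Matrix α α ℂ :=
  Matrix.of fun s t => ∑ u, ρ (s, u) (t, u)

/-- The `N`-qubit W state `(1/√N) ∑ₖ e_{δₖ}`, with the `N` bit positions split as
`3 + m`: vectors of `ℂ^{2^N}` are indexed by pairs of a 3-bit string and an
`m`-bit string. -/
noncomputable def Wsplit3 (N m : ℕ) : (Fin 3 → Fin 2) × (Fin m → Fin 2) → ℂ :=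
  (Real.sqrt N : ℂ)⁻¹ •
    (∑ i : Fin 3, basisVec (oneAt i, fun _ => 0)
      + ∑ j : Fin m, basisVec ((fun _ => 0), oneAt j))

/-- The three-qubit W state `W³ = (e₀₀₁ + e₀₁₀ + e₁₀₀)/√3`, indexed by 3-bit strings. -/
noncomputable def W3bits : (Fin 3 → Fin 2) → ℂ :=
  (Real.sqrt 3 : ℂ)⁻¹ • (∑ i : Fin 3, basisVec (oneAt i))

theorem star_basisVec {α : Type*} [DecidableEq α] (s : α) :
    star (basisVec s) = basisVec s := by
  ext t
  simp [basisVec, apply_ite]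

theorem basisVec_dotProduct {α : Type*} [Fintype α] [DecidableEq α] (s : α) (v : α → ℂ) :
    basisVec s ⬝ᵥ v = v s := by
  simp [basisVec, dotProduct]

theorem basisVec_prod {α β : Type*} [DecidableEq α] [DecidableEq β] (a s : α) (b u : β) :
    basisVec (a, b) (s, u) = basisVec a s * basisVec b u := by
  simp [basisVec, ← ite_and, and_comm]

theorem oneAt_injective {n : ℕ} : Function.Injective (oneAt : Fin n → Fin n → Fin 2) := by
  intro i j h
  simpa [oneAt] using congrFun h i

theorem oneAt_ne_zero {n : ℕ} (i : Fin n) : (fun _ => 0) ≠ oneAt i := by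
  intro h
  simpa [oneAt] using congrFun h i

/-- The unnormalized W state on `n` qubits. -/
noncomputable def excitationSum (n : ℕ) : (Fin n → Fin 2) → ℂ :=
  ∑ i : Fin n, basisVec (oneAt i)

theorem star_excitationSum (n : ℕ) : star (excitationSum n) = excitationSum n := by
  simp [excitationSum, star_sum, star_basisVec]

theorem excitationSum_zero (n : ℕ) : excitationSum n (fun _ => 0) = 0 := by
  simp [excitationSum, basisVec, oneAt_ne_zero]

theorem excitationSum_oneAt {n : ℕ} (i : Fin n) : excitationSum n (oneAt i) = 1 := by
  simp [excitationSum, basisVec, oneAt_injective.eq_iff]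

theorem excitationSum_dotProduct_self (n : ℕ) :
    excitationSum n ⬝ᵥ excitationSum n = n := by
  conv_lhs => arg 1; rw [excitationSum]
  simp [sum_dotProduct, basisVec_dotProduct, excitationSum_oneAt]

theorem Wsplit3_apply (N m : ℕ) (s : Fin 3 → Fin 2) (u : Fin m → Fin 2) :
    Wsplit3 N m (s, u) = (Real.sqrt N : ℂ)⁻¹ *
      (excitationSum 3 s * basisVec (fun _ => 0) u
        + basisVec (fun _ => 0) s * excitationSum m u) := by
  simp [Wsplit3, excitationSum, basisVec_prod, Finset.sum_mul, Finset.mul_sum]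

theorem inv_sqrt_mul_self (n : ℕ) :
    (Real.sqrt n : ℂ)⁻¹ * (Real.sqrt n : ℂ)⁻¹ = (n : ℂ)⁻¹ := by
  rw [← mul_inv, ← Complex.ofReal_mul, Real.mul_self_sqrt n.cast_nonneg, Complex.ofReal_natCast]

/-- Eq. (12) of the paper: for `N ≥ 4`, the partial trace of
`|W^N⟩⟨W^N|` over the last `N − 3` qubits equals
`(3/N)|W³⟩⟨W³| + (1 − 3/N)|000⟩⟨000|`. -/
theorem persistency_stmt7 (N m : ℕ) (hN : 4 ≤ N) (hm : N = 3 + m) :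
    ptrace (vecMulVec (Wsplit3 N m) (star (Wsplit3 N m)))
      = (3 / N : ℂ) • vecMulVec W3bits (star W3bits)
        + (1 - 3 / N : ℂ) •
            vecMulVec (basisVec (fun _ => 0)) (star (basisVec (fun _ => 0))) := by
  have hN0 : (N : ℂ) ≠ 0 := by exact_mod_cast (by omega : N ≠ 0)
  have hNm : (N : ℂ) = 3 + m := by exact_mod_cast hm
  have star_b {n : ℕ} (s : Fin n → Fin 2) :
      star (basisVec (fun _ => 0) s) = basisVec (fun _ => 0) s :=
    congrFun (star_basisVec _) s
  have star_e {n : ℕ} (s : Fin n → Fin 2) : star (excitationSum n s) = excitationSum n s :=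
    congrFun (star_excitationSum n) s
  have star_c (x : ℝ) : star ((x : ℂ)⁻¹) = (x : ℂ)⁻¹ := by simp
  have hbb : ∑ u : Fin m → Fin 2, basisVec (fun _ => 0) u * basisVec (fun _ => 0) u = 1 :=
    (basisVec_dotProduct _ _).trans (by simp [basisVec])
  have hbe : ∑ u : Fin m → Fin 2, basisVec (fun _ => 0) u * excitationSum m u = 0 :=
    (basisVec_dotProduct _ _).trans (excitationSum_zero m)
  have hee : ∑ u : Fin m → Fin 2, excitationSum m u * excitationSum m u = m :=
    excitationSum_dotProduct_self m
  have h3 := inv_sqrt_mul_self 3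
  push_cast at h3
  ext s t
  have hW3 (s : Fin 3 → Fin 2) : W3bits s = (Real.sqrt 3 : ℂ)⁻¹ * excitationSum 3 s := by
    simp [W3bits, excitationSum]
  simp only [ptrace, of_apply, vecMulVec_apply, Pi.star_apply, Matrix.add_apply,
    Matrix.smul_apply, smul_eq_mul, Wsplit3_apply, hW3, star_mul', star_add, star_b, star_e, star_c]
  calc
    _ = ∑ u : Fin m → Fin 2, (N : ℂ)⁻¹ *
        (excitationSum 3 s * excitationSum 3 t *
            (basisVec (fun _ => 0) u * basisVec (fun _ => 0) u)
          + (excitationSum 3 s * basisVec (fun _ => 0) t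
              + basisVec (fun _ => 0) s * excitationSum 3 t) *
            (basisVec (fun _ => 0) u * excitationSum m u)
          + basisVec (fun _ => 0) s * basisVec (fun _ => 0) t *
            (excitationSum m u * excitationSum m u)) := by
      refine Finset.sum_congr rfl fun u _ => ?_
      rw [← inv_sqrt_mul_self N]
      ring
    _ = (N : ℂ)⁻¹ * (excitationSum 3 s * excitationSum 3 t
          + basisVec (fun _ => 0) s * basisVec (fun _ => 0) t * m) := by
      simp only [← Finset.mul_sum, Finset.sum_add_distrib, hbb, hbe, hee, mul_one, mul_zero,
        add_zero]
    _ = 3 / N * (((Real.sqrt 3 : ℂ)⁻¹ * (Real.sqrt 3 : ℂ)⁻¹) *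
            (excitationSum 3 s * excitationSum 3 t))
          + (1 - 3 / N) * (basisVec (fun _ => 0) s * basisVec (fun _ => 0) t) := by
      rw [h3, eq_sub_of_add_eq' hNm.symm]
      field_simp
    _ = _ := by ring
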